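/- Let ρ be a Borel measure on ℝ that is finite on all compact sets. Then there exists an entire function g : ℂ → ℂ such that for every λ ∈ ℝ the value g(λ) is real with g(λ) ≥ 0, and ∫_ℝ e^{−2 g(λ)} dρ(λ) < ∞. -/

import Mathlib

open MeasureTheory

/-- If `k n ≥ n`, the series `∑ (b / (n + 1) ^ 2) ^ k n` converges for every `b ≥ 0`. -/
theorem summable_div_succ_sq_pow {k : ℕ → ℕ} (hk : ∀ n, n ≤ k n) {b : ℝ} (hb : 0 ≤ b) :
    Summable fun n : ℕ => (b / ((n : ℝ) + 1) ^ 2) ^ k n := by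
  have hlim : Filter.Tendsto (fun n : ℕ => b / ((n : ℝ) + 1) ^ 2) Filter.atTop (nhds 0) :=
    Filter.Tendsto.const_div_atTop ((Filter.tendsto_pow_atTop two_ne_zero).comp
      (Filter.tendsto_atTop_add_const_right _ 1 tendsto_natCast_atTop_atTop)) b
  refine Summable.of_norm_bounded_eventually_nat summable_geometric_two ?_
  filter_upwards [hlim.eventually_le_const (show (0 : ℝ) < 1 / 2 by norm_num)] with n hn
  have h0 : 0 ≤ b / ((n : ℝ) + 1) ^ 2 := by positivity
  rw [Real.norm_of_nonneg (pow_nonneg h0 _)]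
  exact (pow_le_pow_left₀ h0 hn _).trans
    (pow_le_pow_of_le_one (by norm_num) (by norm_num) (hk n))

/-- For every real sequence `c` there is an entire function that is real and nonnegative on the
real axis and at least `c n` at every real `x` with `⌊|x|⌋ = n`. -/
theorem exists_entire_ge_floor_abs (c : ℕ → ℝ) :
    ∃ g : ℂ → ℂ, Differentiable ℂ g ∧ (∀ x : ℝ, (g x).im = 0 ∧ 0 ≤ (g x).re) ∧
      ∀ x : ℝ, c ⌊|x|⌋₊ ≤ (g x).re := by
  set k : ℕ → ℕ := fun n => n + ⌈c n⌉₊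
  have hk : ∀ n, n ≤ k n := fun n => Nat.le_add_right _ _
  set t : ℝ → ℕ → ℝ := fun x n => (4 * (x ^ 2 + 1) / ((n : ℝ) + 1) ^ 2) ^ k n with ht
  have ht0 : ∀ x n, 0 ≤ t x n := fun x n => by positivity
  have hts : ∀ x, Summable (t x) := fun x => summable_div_succ_sq_pow hk (by positivity)
  set g : ℂ → ℂ := fun z => ∑' n : ℕ, (4 * (z ^ 2 + 1) / ((n : ℂ) + 1) ^ 2) ^ k n
  have hgr : ∀ x : ℝ, g x = ((∑' n, t x n : ℝ) : ℂ) := fun x => by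
    rw [Complex.ofReal_tsum]
    exact tsum_congr fun n => by simp [ht]
  refine ⟨g, fun z => ?_, fun x => ?_, fun x => ?_⟩
  · have hd : DifferentiableOn ℂ g (Metric.ball 0 (‖z‖ + 1)) := by
      refine Complex.differentiableOn_tsum_of_summable_norm (hts (‖z‖ + 1)) (fun n => ?_)
        Metric.isOpen_ball fun n w hw => ?_
      · fun_prop
      · have hw' : ‖w‖ ≤ ‖z‖ + 1 := (mem_ball_zero_iff.mp hw).le
        have hn : ‖(n : ℂ) + 1‖ = (n : ℝ) + 1 := by
          exact_mod_cast Complex.norm_natCast (n + 1)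
        have hw2 : ‖w ^ 2 + 1‖ ≤ (‖z‖ + 1) ^ 2 + 1 := by
          refine (norm_add_le _ _).trans ?_
          rw [norm_pow, norm_one]
          gcongr
        rw [norm_pow, norm_div, norm_mul, norm_pow, hn, Complex.norm_ofNat]
        simp only [ht]
        gcongr
    exact hd.differentiableAt (Metric.isOpen_ball.mem_nhds (by simp))
  · rw [hgr, Complex.ofReal_im, Complex.ofReal_re]
    exact ⟨rfl, tsum_nonneg (ht0 x)⟩
  · rw [hgr, Complex.ofReal_re]
    set n := ⌊|x|⌋₊
    have hn : (n : ℝ) ≤ |x| := Nat.floor_le (abs_nonneg x)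
    have hx : (n : ℝ) ^ 2 ≤ x ^ 2 := by
      rw [← sq_abs x]
      gcongr
    have h2 : 2 ≤ 4 * (x ^ 2 + 1) / ((n : ℝ) + 1) ^ 2 := by
      rw [le_div_iff₀ (by positivity)]
      nlinarith [sq_nonneg ((n : ℝ) - 1)]
    calc c n ≤ ⌈c n⌉₊ := Nat.le_ceil _
      _ ≤ (k n : ℝ) := by exact_mod_cast Nat.le_add_left _ _
      _ ≤ (2 : ℝ) ^ k n := by exact_mod_cast (Nat.lt_two_pow_self).le
      _ ≤ t x n := pow_le_pow_left₀ zero_le_two h2 _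
      _ ≤ ∑' n, t x n := (hts x).le_tsum n fun m _ => ht0 x m

/-- First assertion of Theorem 2.6: for a Borel measure `ρ` on `ℝ` which is finite
on compact sets, there exists an entire function `g` which is real and nonnegative
on the real axis and such that `∫ e^{−2g(λ)} dρ(λ) < ∞`. -/
theorem exists_entire_weight
    (ρ : Measure ℝ) [IsFiniteMeasureOnCompacts ρ] :
    ∃ g : ℂ → ℂ, Differentiable ℂ g ∧
      (∀ lam : ℝ, (g lam).im = 0 ∧ 0 ≤ (g lam).re) ∧
      Integrable (fun lam : ℝ => Real.exp (-2 * (g lam).re)) ρ := by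
  set K : ℕ → Set ℝ := fun n => Set.Icc (-((n : ℝ) + 1)) (n + 1)
  obtain ⟨g, hgd, hg0, hg⟩ := exists_entire_ge_floor_abs fun n => n + ρ.real (K n)
  refine ⟨g, hgd, hg0, ?_⟩
  have hcont : Continuous fun x : ℝ => Real.exp (-2 * (g x).re) := by
    have := hgd.continuous
    fun_prop
  refine ⟨hcont.aestronglyMeasurable, ?_⟩
  set C : ℕ → ℝ := fun n => Real.exp (-2 * (n + ρ.real (K n)))
  have hC : ∀ n, C n * ρ.real (K n) ≤ Real.exp (-n) := fun n => by
    have ha : 0 ≤ ρ.real (K n) := measureReal_nonneg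
    calc C n * ρ.real (K n) ≤ C n * Real.exp (ρ.real (K n)) := by
          gcongr
          linarith [Real.add_one_le_exp (ρ.real (K n))]
      _ = Real.exp (-2 * (n + ρ.real (K n)) + ρ.real (K n)) := (Real.exp_add _ _).symm
      _ ≤ Real.exp (-n) := by
          gcongr
          linarith [(Nat.cast_nonneg n : (0 : ℝ) ≤ n)]
  calc ∫⁻ x, ‖Real.exp (-2 * (g x).re)‖ₑ ∂ρ
      ≤ ∫⁻ x, ∑' n, (K n).indicator (fun _ => ENNReal.ofReal (C n)) x ∂ρ := by
        refine lintegral_mono fun x => ?_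
        have hx : x ∈ K ⌊|x|⌋₊ := abs_le.mp (Nat.lt_floor_add_one |x|).le
        refine le_trans ?_ (ENNReal.le_tsum ⌊|x|⌋₊)
        rw [Set.indicator_of_mem hx, Real.enorm_of_nonneg (Real.exp_pos _).le]
        exact ENNReal.ofReal_le_ofReal (Real.exp_le_exp.mpr (by linarith [hg x]))
    _ = ∑' n, ENNReal.ofReal (C n) * ρ (K n) := by
        rw [lintegral_tsum fun n => (measurable_const.indicator measurableSet_Icc).aemeasurable]
        exact tsum_congr fun n => lintegral_indicator_const measurableSet_Icc _
    _ ≤ ∑' n : ℕ, ENNReal.ofReal (Real.exp (-n)) := by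
        refine ENNReal.tsum_le_tsum fun n => ?_
        rw [← ofReal_measureReal (isCompact_Icc.measure_lt_top.ne),
          ← ENNReal.ofReal_mul (Real.exp_pos _).le]
        exact ENNReal.ofReal_le_ofReal (hC n)
    _ < ⊤ := Real.summable_exp_neg_nat.tsum_ofReal_lt_top
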